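/- Let h : Ω → ℝ be an integrable random variable and X : Ω → ℝ^k a random vector. Then E[h | X] = 0 almost surely if and only if E[h · exp(i u'Φ(X))] = 0 for all u ∈ ℝ^k, where Φ : ℝ^k → ℝ^k applies a fixed continuous strictly increasing bounded bijection (e.g., the standard normal CDF in each coordinate) coordinatewise, and i is the imaginary unit. -/

import Mathlib

open MeasureTheory

lemma aux_int {Ω E : Type*} [MeasurableSpace Ω] [MeasurableSpace E] (μ : Measure Ω)
    (h : Ω → ℝ) (Y : Ω → E) (hh : Integrable h μ) (hY : Measurable Y)
    (g : E → ℂ) (hg : Measurable g) (hb : ∀ y, ‖g y‖ ≤ 1) :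
    ∫ ω, (h ω : ℂ) * g (Y ω) ∂μ =
      ∫ y, g y ∂((μ.withDensity fun ω => ENNReal.ofReal (h ω)).map Y) -
      ∫ y, g y ∂((μ.withDensity fun ω => ENNReal.ofReal (-h ω)).map Y) := by
  rw [integral_map hY.aemeasurable hg.aestronglyMeasurable,
    integral_map hY.aemeasurable hg.aestronglyMeasurable,
    integral_withDensity_eq_integral_toReal_smul₀ hh.aemeasurable.ennreal_ofReal
      (by simp),
    integral_withDensity_eq_integral_toReal_smul₀ (f := fun ω => ENNReal.ofReal (-h ω)) hh.neg.aemeasurable.ennreal_ofReal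
      (by simp)]
  have key : ∀ f : Ω → ℝ, Integrable f μ →
      Integrable (fun ω => (ENNReal.ofReal (f ω)).toReal • g (Y ω)) μ := by
    intro f hf
    have h1 : Integrable (fun ω => (ENNReal.ofReal (f ω)).toReal) μ := by
      simpa [ENNReal.toReal_ofReal'] using hf.pos_part
    exact h1.smul_bdd 1 (hg.comp hY).aestronglyMeasurable (Filter.Eventually.of_forall fun ω => hb _)
  rw [← integral_sub (key h hh) (key (fun ω => -h ω) hh.neg)]
  congr 1
  ext ω
  rw [← sub_smul, Complex.real_smul]
  congr 2
  simp only [ENNReal.toReal_ofReal']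
  rcases le_total (h ω) 0 with h0 | h0
  · rw [max_eq_right h0, max_eq_left (by linarith)]; ring
  · rw [max_eq_left h0, max_eq_right (by linarith)]; ring

lemma aux_set {Ω E : Type*} [MeasurableSpace Ω] [MeasurableSpace E] (μ : Measure Ω)
    (h : Ω → ℝ) (Y : Ω → E) (hh : Integrable h μ) (hY : Measurable Y) :
    (μ.withDensity fun ω => ENNReal.ofReal (h ω)).map Y =
      (μ.withDensity fun ω => ENNReal.ofReal (-h ω)).map Y ↔
    ∀ s, MeasurableSet s → ∫ ω in Y ⁻¹' s, h ω ∂μ = 0 := by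
  have f1 : IsFiniteMeasure (μ.withDensity fun ω => ENNReal.ofReal (h ω)) :=
    isFiniteMeasure_withDensity_ofReal hh.2
  have f2 : IsFiniteMeasure (μ.withDensity fun ω => ENNReal.ofReal (-h ω)) :=
    isFiniteMeasure_withDensity_ofReal hh.neg.2
  rw [Measure.ext_iff]
  refine forall₂_congr fun s hs => ?_
  have m1 := measure_ne_top (μ.withDensity fun ω => ENNReal.ofReal (h ω)) (Y ⁻¹' s)
  have m2 := measure_ne_top (μ.withDensity fun ω => ENNReal.ofReal (-h ω)) (Y ⁻¹' s)
  rw [Measure.map_apply hY hs, Measure.map_apply hY hs]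
  rw [withDensity_apply _ (hY hs)] at m1 m2 ⊢
  rw [withDensity_apply _ (hY hs)]
  rw [integral_eq_lintegral_pos_part_sub_lintegral_neg_part hh.integrableOn, sub_eq_zero,
    ENNReal.toReal_eq_toReal_iff' m1 m2]

lemma aux_cond {Ω E : Type*} [MeasurableSpace Ω] [mE : MeasurableSpace E] (μ : Measure Ω)
    [IsFiniteMeasure μ]
    (h : Ω → ℝ) (Y : Ω → E) (hh : Integrable h μ) (hY : Measurable Y) :
    (μ[h | MeasurableSpace.comap Y mE] =ᵐ[μ] 0) ↔
    ∀ s, MeasurableSet s → ∫ ω in Y ⁻¹' s, h ω ∂μ = 0 := by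
  constructor
  · intro H s hs
    rw [← setIntegral_condExp hY.comap_le hh ⟨s, hs, rfl⟩]
    rw [setIntegral_congr_ae (g := fun _ => 0) (hY hs) (H.mono fun _ hx _ => hx)]
    simp
  · intro H
    refine (ae_eq_condExp_of_forall_setIntegral_eq hY.comap_le hh ?_ ?_ ?_).symm
    · intro s _ _; exact (integrable_zero _ _ _).integrableOn
    · rintro _ ⟨s, hs, rfl⟩ _
      simp [H s hs]
    · exact aestronglyMeasurable_zero

/-- Characteristic-function characterization of a conditional moment restriction:
`E[h|X] = 0` a.s. iff `E[h · exp(i u'Φ(X))] = 0` for all `u`, where `Φ` applies a fixed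
continuous, strictly increasing, bounded one-to-one map coordinatewise. -/
theorem statement4 {Ω : Type*} [MeasurableSpace Ω] (μ : Measure Ω) [IsProbabilityMeasure μ]
    {k : ℕ} (h : Ω → ℝ) (X : Ω → Fin k → ℝ)
    (hh : Integrable h μ) (hX : Measurable X)
    (φ : ℝ → ℝ) (hφc : Continuous φ) (hφm : StrictMono φ) (hφb : ∃ M, ∀ x, |φ x| ≤ M) :
    (μ[h | MeasurableSpace.comap X inferInstance] =ᵐ[μ] 0) ↔
      ∀ u : Fin k → ℝ,
        ∫ ω, (h ω : ℂ) *
          Complex.exp (Complex.I * (∑ i, (u i : ℂ) * (φ (X ω i) : ℂ))) ∂μ = 0 := by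
  let Φ : (Fin k → ℝ) → Fin k → ℝ := fun x i => φ (x i)
  have hΦc : Continuous Φ := by fun_prop
  have hΦi : Function.Injective Φ := fun x y hxy => funext fun i =>
    hφm.injective (congrFun hxy i)
  have hΦ : MeasurableEmbedding Φ := hΦc.measurableEmbedding hΦi
  have hY : Measurable (Φ ∘ X) := hΦ.measurable.comp hX
  have hcomap : MeasurableSpace.comap X inferInstance
      = MeasurableSpace.comap (Φ ∘ X) inferInstance := by
    rw [← MeasurableSpace.comap_comp, hΦ.comap_eq]
  rw [hcomap, aux_cond μ h _ hh hY, ← aux_set μ h _ hh hY]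
  have f1 : IsFiniteMeasure (μ.withDensity fun ω => ENNReal.ofReal (h ω)) :=
    isFiniteMeasure_withDensity_ofReal hh.2
  have f2 : IsFiniteMeasure (μ.withDensity fun ω => ENNReal.ofReal (-h ω)) :=
    isFiniteMeasure_withDensity_ofReal hh.neg.2
  have key : ∀ u : Fin k → ℝ, ∫ ω, (h ω : ℂ) *
      Complex.exp (Complex.I * (∑ i, (u i : ℂ) * (φ (X ω i) : ℂ))) ∂μ = _ := fun u =>
    aux_int μ h (Φ ∘ X) hh hY
      (fun y => Complex.exp (Complex.I * (∑ i, (u i : ℂ) * (y i : ℂ)))) (by fun_prop)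
      (fun y => by
        rw [mul_comm]
        have := Complex.norm_exp_ofReal_mul_I (∑ i, u i * y i)
        push_cast at this
        exact this.le)
  constructor
  · intro H u
    rw [key u, H, sub_self]
  · intro H
    apply Measure.ext_of_charFunDual
    ext L
    have hL := H (fun i => L (Pi.single i 1))
    rw [key, sub_eq_zero] at hL
    have e : ∀ y : Fin k → ℝ, Complex.exp (L y * Complex.I) =
        Complex.exp (Complex.I * (∑ i, (L (Pi.single i 1) : ℂ) * (y i : ℂ))) := by
      intro y
      rw [mul_comm]
      congr 2
      have : L y = ∑ i, L (Pi.single i 1) * y i := by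
        conv_lhs => rw [pi_eq_sum_univ' y]
        simp [map_sum, mul_comm, Pi.single_apply, ← Pi.single_apply]
      rw [this]; push_cast; rfl
    simp only [charFunDual_apply, e]
    exact hL
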